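/- Let α be a type-B composition of n and let π ∈ H_α. Then the set {σ ∈ H_α(231) : Inv(σ) ⊆ Inv(π)} has a greatest element with respect to inclusion of inversion sets: there exists a (necessarily unique) σ₀ ∈ H_α(231) with Inv(σ₀) ⊆ Inv(π) such that Inv(σ) ⊆ Inv(σ₀) for every σ ∈ H_α(231) with Inv(σ) ⊆ Inv(π). -/

import Mathlib

namespace TypeB

/-- A sign-symmetric permutation of degree `n`: a bijection of `ℤ` with
`π(-i) = -π(i)` which fixes every integer of absolute value `> n`.
It restricts to a sign-symmetric permutation of `±[n]`. -/
structure SignedPerm (n : ℕ) where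
  perm : Equiv.Perm ℤ
  sign_symm : ∀ i : ℤ, perm (-i) = - perm i
  outside : ∀ i : ℤ, (n : ℤ) < |i| → perm i = i

/-- Symbols for type-B inversions: `neg i` is `[i]`, `pair i j` (with `i < j`)
is `(i,j)`, and `mixed i j` (with `i < j`) is `(−j, i)`. -/
inductive BInv (n : ℕ) : Type where
  | neg : ℕ → BInv n
  | pair : ℕ → ℕ → BInv n
  | mixed : ℕ → ℕ → BInv n
deriving DecidableEq

/-- `i⁺`: `i+1` if `i ≠ -1`, and `1` for `i = -1`. -/
def iplus (i : ℤ) : ℤ := if i = -1 then 1 else i + 1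

/-- The inversion set of a sign-symmetric permutation. -/
def Inv {n : ℕ} (π : SignedPerm n) : Set (BInv n) := fun t =>
  match t with
  | .neg i => 1 ≤ i ∧ i ≤ n ∧ π.perm (i : ℤ) < 0
  | .pair i j => 1 ≤ i ∧ i < j ∧ j ≤ n ∧ π.perm (j : ℤ) < π.perm (i : ℤ)
  | .mixed i j => 1 ≤ i ∧ i < j ∧ j ≤ n ∧ π.perm (i : ℤ) + π.perm (j : ℤ) < 0

/-- The cover-inversion set of a sign-symmetric permutation. -/
def Cov {n : ℕ} (π : SignedPerm n) : Set (BInv n) := fun t =>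
  match t with
  | .neg i => 1 ≤ i ∧ i ≤ n ∧ π.perm (i : ℤ) = -1
  | .pair i j => 1 ≤ i ∧ i < j ∧ j ≤ n ∧ π.perm (i : ℤ) = iplus (π.perm (j : ℤ))
  | .mixed i j => 1 ≤ i ∧ i < j ∧ j ≤ n ∧ π.perm (-(j : ℤ)) = iplus (π.perm (i : ℤ))

/-- The symbol `(−j, i)` in canonical form (it equals `(−i, j)`). -/
def mixedInv {n : ℕ} (i j : ℕ) : BInv n := .mixed (min i j) (max i j)

/-- A type-B composition of `n`: positive parts summing to `n`,
together with a split/join label. -/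
structure BComp (n : ℕ) where
  parts : List ℕ
  pos : ∀ a ∈ parts, 0 < a
  sum_eq : parts.sum = n
  isJoin : Bool

/-- The partial sum `p_i = α₁ + ⋯ + α_i`. -/
def pSum {n : ℕ} (α : BComp n) (i : ℕ) : ℕ := (α.parts.take i).sum

/-- The α-region of `a ∈ [n]`: the unique `i` with `p_{i-1} < a ≤ p_i`. -/
def region {n : ℕ} (α : BComp n) (a : ℕ) : ℕ :=
  ((Finset.range α.parts.length).filter (fun j => pSum α j < a)).card

/-- The first part `α₁` of a type-B composition. -/
def alpha1 {n : ℕ} (α : BComp n) : ℕ := α.parts.headI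

/-- Index of the block of `Part(α)` containing `x ∈ ±[n]`; two elements lie in
a common block of `Part(α)` iff their indices agree. -/
def blockIdx {n : ℕ} (α : BComp n) (x : ℤ) : ℤ :=
  if 0 < x then
    (if α.isJoin = true ∧ region α x.toNat = 1 then 0 else (region α x.toNat : ℤ))
  else
    (if α.isJoin = true ∧ region α (-x).toNat = 1 then 0 else -(region α (-x).toNat : ℤ))

/-- Membership in `±[n]`. -/
def inPM (n : ℕ) (x : ℤ) : Prop := x ≠ 0 ∧ -(n : ℤ) ≤ x ∧ x ≤ (n : ℤ)

/-- `π ∈ H_α`: `π` is increasing on every block of `Part(α)`. -/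
def memH {n : ℕ} (α : BComp n) (π : SignedPerm n) : Prop :=
  ∀ a b : ℤ, inPM n a → inPM n b → a < b → blockIdx α a = blockIdx α b →
    π.perm a < π.perm b

/-- Common part of the type-B `(α,231)`- and `(α,312)`-patterns: indices
`i < j < k` in `±[n]`, in pairwise distinct blocks of `Part(α)`, with `j > 0`
and `π(i) = π(k)⁺`. -/
def patternCore {n : ℕ} (α : BComp n) (π : SignedPerm n) (i j k : ℤ) : Prop :=
  inPM n i ∧ inPM n j ∧ inPM n k ∧ i < j ∧ j < k ∧ 0 < j ∧
  blockIdx α i ≠ blockIdx α j ∧ blockIdx α j ≠ blockIdx α k ∧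
  blockIdx α i ≠ blockIdx α k ∧ π.perm i = iplus (π.perm k)

/-- `π` has a type-B `(α,231)`-split (resp. -join) pattern, according to the
label of `α`. -/
def has231 {n : ℕ} (α : BComp n) (π : SignedPerm n) : Prop :=
  ∃ i j k : ℤ, patternCore α π i j k ∧
    (if α.isJoin = true then
       (((alpha1 α : ℤ) < j → π.perm i < π.perm j) ∧
        (j ≤ (alpha1 α : ℤ) → π.perm j < π.perm k))
     else π.perm i < π.perm j)

/-- `π` has a type-B `(α,312)`-split (resp. -join) pattern, according to the
label of `α`. -/
def has312 {n : ℕ} (α : BComp n) (π : SignedPerm n) : Prop :=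
  ∃ i j k : ℤ, patternCore α π i j k ∧
    (if α.isJoin = true then
       (((alpha1 α : ℤ) < j → π.perm j < π.perm k) ∧
        (j ≤ (alpha1 α : ℤ) → π.perm i < π.perm j))
     else π.perm j < π.perm k)

/-- `π ∈ H_α(231)`. -/
def mem231 {n : ℕ} (α : BComp n) (π : SignedPerm n) : Prop := memH α π ∧ ¬ has231 α π

/-- `π ∈ H_α(312)`. -/
def mem312 {n : ℕ} (α : BComp n) (π : SignedPerm n) : Prop := memH α π ∧ ¬ has312 α π

/-- The set `H_α`. -/
def Hset {n : ℕ} (α : BComp n) : Set (SignedPerm n) := {π | memH α π}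

/-- The carrier of `Tam_B(α)`, namely `H_α(231)`. -/
def Tset {n : ℕ} (α : BComp n) : Set (SignedPerm n) := {π | mem231 α π}

/-- The weak order: inclusion of inversion sets. -/
def wle {n : ℕ} (π σ : SignedPerm n) : Prop := Inv π ⊆ Inv σ

/-- `m` is the greatest lower bound of `x` and `y` within `P`, w.r.t. the weak order. -/
def isMeetIn {n : ℕ} (P : Set (SignedPerm n)) (x y m : SignedPerm n) : Prop :=
  m ∈ P ∧ wle m x ∧ wle m y ∧ ∀ z ∈ P, wle z x → wle z y → wle z m

/-- `u` is the least upper bound of `x` and `y` within `P`, w.r.t. the weak order. -/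
def isJoinIn {n : ℕ} (P : Set (SignedPerm n)) (x y u : SignedPerm n) : Prop :=
  u ∈ P ∧ wle x u ∧ wle y u ∧ ∀ z ∈ P, wle x z → wle y z → wle u z

/-- `d = Π↓(π)`: `d` is the greatest element of `{σ ∈ H_α(231) : Inv σ ⊆ Inv π}`. -/
def isProjDown {n : ℕ} (α : BComp n) (π d : SignedPerm n) : Prop :=
  mem231 α d ∧ wle d π ∧ ∀ σ, mem231 α σ → wle σ π → wle σ d

/-- `d = Π†(π)`: `d` is the greatest element of `{σ ∈ H_α(312) : Inv σ ⊆ Inv π}`. -/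
def isProjDagger {n : ℕ} (α : BComp n) (π d : SignedPerm n) : Prop :=
  mem312 α d ∧ wle d π ∧ ∀ σ, mem312 α σ → wle σ π → wle σ d

/-- The value `ω_{o;α}(a)` for `a ∈ [n]`. -/
def omegaPos {n : ℕ} (α : BComp n) (a : ℕ) : ℤ :=
  if α.isJoin = true ∧ region α a = 1 then (a : ℤ)
  else -(((pSum α (region α a) : ℤ) + (pSum α (region α a - 1) : ℤ) + 1) - (a : ℤ))

/-- The longest element `ω_{o;α}` of `H_α`, as a function on `ℤ`. -/
def omegaFun {n : ℕ} (α : BComp n) (x : ℤ) : ℤ :=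
  if 0 < x ∧ x ≤ (n : ℤ) then omegaPos α x.toNat
  else if 0 < -x ∧ -x ≤ (n : ℤ) then -(omegaPos α (-x).toNat)
  else x

/-- The set of `m` such that there is a strict chain `x₀ < x₁ < ⋯ < x_m` in `P`. -/
def chainLengths {n : ℕ} (P : Set (SignedPerm n)) : Set ℕ :=
  {m | ∃ f : Fin (m + 1) → SignedPerm n, (∀ i, f i ∈ P) ∧
        ∀ i j : Fin (m + 1), i < j → Inv (f i) ⊂ Inv (f j)}

/-- `x` is join-irreducible in `Tam_B(α)`. -/
def joinIrred {n : ℕ} (α : BComp n) (x : SignedPerm n) : Prop :=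
  x ∈ Tset α ∧ ¬ (∀ y ∈ Tset α, wle x y) ∧
  ∀ y z, y ∈ Tset α → z ∈ Tset α → isJoinIn (Tset α) y z x → x = y ∨ x = z

/-- `x` is meet-irreducible in `Tam_B(α)`. -/
def meetIrred {n : ℕ} (α : BComp n) (x : SignedPerm n) : Prop :=
  x ∈ Tset α ∧ ¬ (∀ y ∈ Tset α, wle y x) ∧
  ∀ y z, y ∈ Tset α → z ∈ Tset α → isMeetIn (Tset α) y z x → x = y ∨ x = z

/-- `x` is left modular in the lattice on `P`: `(r ∨ x) ∧ q = r ∨ (x ∧ q)`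
for all `r ≤ q` in `P`. -/
def leftModular {n : ℕ} (P : Set (SignedPerm n)) (x : SignedPerm n) : Prop :=
  ∀ r q, r ∈ P → q ∈ P → wle r q →
    ∀ u v w1 w2, isJoinIn P r x u → isMeetIn P u q v →
      isMeetIn P x q w1 → isJoinIn P r w1 w2 → v = w2

/-- The simple generator `s_i` as a function on `ℤ`: `s₀` exchanges `1` and `-1`,
and for `i ≥ 1`, `s_i` exchanges `i` with `i+1` and `-i` with `-(i+1)`. -/
def sfun (i : ℕ) (x : ℤ) : ℤ :=
  if i = 0 then (if x = 1 then -1 else if x = -1 then 1 else x)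
  else if x = (i : ℤ) then (i : ℤ) + 1
  else if x = (i : ℤ) + 1 then (i : ℤ)
  else if x = -(i : ℤ) then -(i : ℤ) - 1
  else if x = -(i : ℤ) - 1 then -(i : ℤ)
  else x

/-- `i` is one of the partial sums `p₁, …, p_{r−1}` of `α`. -/
def isPSum {n : ℕ} (α : BComp n) (i : ℕ) : Prop :=
  ∃ j : ℕ, 1 ≤ j ∧ j < α.parts.length ∧ pSum α j = i

/-- `n² − Σᵢ α_i(α_i−1)/2`, minus additionally `(α₁+1)α₁/2` when `α` is join. -/
def lengthFormula {n : ℕ} (α : BComp n) : ℕ :=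
  n ^ 2 - (α.parts.map (fun a => a * (a - 1) / 2)).sum -
    (if α.isJoin = true then (alpha1 α + 1) * alpha1 α / 2 else 0)

namespace SignedPerm

variable {n : ℕ}

theorem perm_zero (σ : SignedPerm n) : σ.perm 0 = 0 := by
  have h := σ.sign_symm 0
  rw [neg_zero] at h
  omega

theorem perm_ne_zero (σ : SignedPerm n) {x : ℤ} (hx : x ≠ 0) : σ.perm x ≠ 0 := fun h =>
  hx (σ.perm.injective (h.trans σ.perm_zero.symm))

theorem abs_perm_le (σ : SignedPerm n) {x : ℤ} (hx : |x| ≤ n) : |σ.perm x| ≤ n := by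
  by_contra! h
  have h' := σ.perm.injective (σ.outside _ h)
  rw [h'] at h
  omega

theorem abs_le_of_abs_perm_le (σ : SignedPerm n) {x : ℤ} (hx : |σ.perm x| ≤ n) : |x| ≤ n := by
  by_contra! h
  rw [σ.outside _ h] at hx
  omega

theorem ext_perm {σ τ : SignedPerm n} (h : σ.perm = τ.perm) : σ = τ := by
  cases σ; cases τ; cases h; rfl

end SignedPerm

/-- The weak order in terms of inversions of all pairs of integers. -/
theorem wle_iff {n : ℕ} {σ π : SignedPerm n} :
    wle σ π ↔ ∀ a b : ℤ, a < b → σ.perm b < σ.perm a → π.perm b < π.perm a := by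
  constructor
  · intro h a b hab hσ
    have hneg : ∀ i : ℕ, 1 ≤ i → i ≤ n → σ.perm i < 0 → π.perm i < 0 := fun i h1 h2 h3 =>
      (h (show BInv.neg i ∈ Inv σ from ⟨h1, h2, h3⟩)).2.2
    have hpair : ∀ i j : ℕ, 1 ≤ i → i < j → j ≤ n → σ.perm j < σ.perm i →
        π.perm j < π.perm i := fun i j h1 h2 h3 h4 =>
      (h (show BInv.pair i j ∈ Inv σ from ⟨h1, h2, h3, h4⟩)).2.2.2
    have hmixed : ∀ i j : ℕ, 1 ≤ i → i < j → j ≤ n → σ.perm i + σ.perm j < 0 →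
        π.perm i + π.perm j < 0 := fun i j h1 h2 h3 h4 =>
      (h (show BInv.mixed i j ∈ Inv σ from ⟨h1, h2, h3, h4⟩)).2.2.2
    have ha : |a| ≤ n := by
      by_contra! ha
      rw [σ.outside a ha] at hσ
      rcases le_or_gt |b| n with hb | hb
      · have := σ.abs_perm_le hb
        rw [abs_le] at this hb
        rw [lt_abs] at ha
        omega
      · rw [σ.outside b hb] at hσ
        omega
    have hb : |b| ≤ n := by
      by_contra! hb
      rw [σ.outside b hb] at hσ
      have := σ.abs_perm_le ha
      rw [abs_le] at this ha
      rw [lt_abs] at hb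
      omega
    rw [abs_le] at ha hb
    have eσa := σ.sign_symm a
    have eσb := σ.sign_symm b
    have eπa := π.sign_symm a
    have eπb := π.sign_symm b
    have zσ := σ.perm_zero
    have zπ := π.perm_zero
    rcases lt_trichotomy a 0 with ha0 | ha0 | ha0
    · obtain ⟨c, hc⟩ := Int.eq_ofNat_of_zero_le (show 0 ≤ -a by omega)
      have hna := hneg c (by omega) (by omega)
      rw [← hc] at hna
      rcases lt_trichotomy b 0 with hb0 | hb0 | hb0
      · obtain ⟨d, hd⟩ := Int.eq_ofNat_of_zero_le (show 0 ≤ -b by omega)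
        have := hpair d c (by omega) (by omega) (by omega)
        rw [← hc, ← hd] at this
        omega
      · subst hb0
        omega
      · obtain ⟨d, hd⟩ := Int.eq_ofNat_of_zero_le hb0.le
        rcases lt_trichotomy c d with hcd | hcd | hcd
        · have := hmixed c d (by omega) hcd (by omega)
          rw [← hc, ← hd] at this
          omega
        · have : b = -a := by omega
          subst this
          omega
        · have := hmixed d c (by omega) hcd (by omega)
          rw [← hc, ← hd] at this
          omega
    · subst ha0
      obtain ⟨d, hd⟩ := Int.eq_ofNat_of_zero_le hab.le
      have := hneg d (by omega) (by omega)
      rw [← hd] at this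
      omega
    · obtain ⟨c, hc⟩ := Int.eq_ofNat_of_zero_le ha0.le
      obtain ⟨d, hd⟩ := Int.eq_ofNat_of_zero_le (show 0 ≤ b by omega)
      have := hpair c d (by omega) (by omega) (by omega)
      rw [← hc, ← hd] at this
      exact this hσ
  · rintro h (i | ⟨i, j⟩ | ⟨i, j⟩) ht
    · obtain ⟨h1, h2, h3⟩ := ht
      refine ⟨h1, h2, ?_⟩
      have := h (-i) i (by omega)
      rw [σ.sign_symm, π.sign_symm] at this
      omega
    · obtain ⟨h1, h2, h3, h4⟩ := ht
      exact ⟨h1, h2, h3, h i j (by omega) h4⟩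
    · obtain ⟨h1, h2, h3, h4⟩ := ht
      refine ⟨h1, h2, h3, ?_⟩
      have := h (-j) i (by omega)
      rw [σ.sign_symm, π.sign_symm] at this
      omega

theorem wle_antisymm {n : ℕ} {σ τ : SignedPerm n} (h₁ : wle σ τ) (h₂ : wle τ σ) : σ = τ := by
  rw [wle_iff] at h₁ h₂
  have key : ∀ a b, σ.perm a ≤ σ.perm b ↔ τ.perm a ≤ τ.perm b := by
    intro a b
    rcases lt_trichotomy a b with hab | rfl | hab
    · rw [← not_lt, ← not_lt]
      exact not_congr ⟨h₁ a b hab, h₂ a b hab⟩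
    · simp
    · have ha := σ.perm.injective.ne hab.ne
      have hb := τ.perm.injective.ne hab.ne
      have := h₁ b a hab
      have := h₂ b a hab
      omega
  let f : ℤ ≃o ℤ :=
    { toEquiv := σ.perm.symm.trans τ.perm
      map_rel_iff' := fun {a b} => by
        have := key (σ.perm.symm a) (σ.perm.symm b)
        simpa using this.symm }
  have hf0 : f 0 = 0 := by
    have : σ.perm.symm 0 = 0 := by rw [Equiv.symm_apply_eq, σ.perm_zero]
    change τ.perm (σ.perm.symm 0) = 0
    rw [this, τ.perm_zero]
  have hsucc : ∀ x, f (x + 1) = f x + 1 := fun x => f.map_succ x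
  have hf : ∀ x, f x = x := by
    intro x
    induction x with
    | zero => exact hf0
    | succ i ih => rw [hsucc, ih]
    | pred i ih =>
      have := hsucc (-(i : ℤ) - 1)
      rw [sub_add_cancel] at this
      omega
  apply SignedPerm.ext_perm
  ext a
  have h : τ.perm (σ.perm.symm (σ.perm a)) = σ.perm a := hf (σ.perm a)
  rw [Equiv.symm_apply_apply] at h
  exact h.symm

theorem region_mono {n : ℕ} (α : BComp n) : Monotone (region α) := fun _ _ hab =>
  Finset.card_le_card fun _ hj => by
    rw [Finset.mem_filter] at hj ⊢
    exact ⟨hj.1, hj.2.trans_le hab⟩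

theorem blockIdx_mono {n : ℕ} (α : BComp n) : Monotone (blockIdx α) := by
  intro a b hab
  unfold blockIdx
  have h₁ := fun h : a.toNat ≤ b.toNat => region_mono α h
  have h₂ := fun h : (-b).toNat ≤ (-a).toNat => region_mono α h
  have h₃ := h₁ (by omega)
  have h₄ := h₂ (by omega)
  split_ifs <;> grind

theorem memH_of_wle {n : ℕ} {α : BComp n} {σ π : SignedPerm n} (hπ : memH α π)
    (h : wle σ π) : memH α σ := by
  rw [wle_iff] at h
  intro a b ha hb hab hblock
  have h₁ := hπ a b ha hb hab hblock
  have h₂ := h a b hab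
  have h₃ := σ.perm.injective.ne hab.ne
  omega

theorem inPM_iff {n : ℕ} {x : ℤ} : inPM n x ↔ x ≠ 0 ∧ |x| ≤ n := by
  rw [inPM, abs_le]

/-- If every position whose value lies between `σ k` and `σ i` is outside the open interval
`(i, k)`, then some cover inversion straddles that interval. -/
theorem exists_cover_straddling {n : ℕ} (σ : SignedPerm n) {i k : ℤ} (hi : inPM n i)
    (hk : inPM n k) (hσ : σ.perm k < σ.perm i)
    (hout : ∀ p : ℤ, p ≠ 0 → σ.perm k ≤ σ.perm p → σ.perm p ≤ σ.perm i → p ≤ i ∨ k ≤ p) :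
    ∃ i' k' : ℤ, inPM n i' ∧ inPM n k' ∧ i' ≤ i ∧ k ≤ k' ∧ σ.perm k ≤ σ.perm k' ∧
      σ.perm i' ≤ σ.perm i ∧ σ.perm i' = iplus (σ.perm k') := by
  rw [inPM_iff] at hi hk
  obtain ⟨v, ⟨q, rfl, hq0, hkq, hqi, hq⟩, hmax⟩ := Int.exists_greatest_of_bdd
    (P := fun v => ∃ q, σ.perm q = v ∧ q ≠ 0 ∧ σ.perm k ≤ v ∧ v < σ.perm i ∧ k ≤ q)
    ⟨σ.perm i, fun z hz => by obtain ⟨_, _, _, _, h, _⟩ := hz; exact h.le⟩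
    ⟨σ.perm k, k, rfl, hk.1, le_rfl, hσ, le_rfl⟩
  obtain ⟨p, hp⟩ := σ.perm.surjective (iplus (σ.perm q))
  have hi0 := σ.perm_ne_zero hi.1
  have hlt : σ.perm q < σ.perm p ∧ σ.perm p ≤ σ.perm i := by
    rw [hp]
    unfold iplus
    split_ifs <;> omega
  have hq0' := σ.perm_ne_zero hq0
  have hp0 : p ≠ 0 := by
    rintro rfl
    rw [σ.perm_zero] at hp
    unfold iplus at hp
    split_ifs at hp <;> omega
  have hbi := σ.abs_perm_le hi.2
  have hbk := σ.abs_perm_le hk.2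
  refine ⟨p, q, inPM_iff.2 ⟨hp0, σ.abs_le_of_abs_perm_le ?_⟩,
    inPM_iff.2 ⟨hq0, σ.abs_le_of_abs_perm_le ?_⟩, ?_, hq, hkq, hlt.2, hp⟩
  · rw [abs_le] at *; omega
  · rw [abs_le] at *; omega
  · rcases hout p hp0 (by omega) hlt.2 with h | h
    · exact h
    · rcases hlt.2.lt_or_eq with h' | h'
      · have := hmax _ ⟨p, rfl, hp0, by omega, h', h⟩
        omega
      · exact (σ.perm.injective h').le

/-- The outer positions of a pattern of `π` form no inversion of any `σ ≤ π` avoiding patterns. -/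
theorem not_inv_of_pattern {n : ℕ} {α : BComp n} {σ π : SignedPerm n} (hσ : mem231 α σ)
    (hle : wle σ π) {i j k : ℤ} (hcore : patternCore α π i j k)
    (hcond : if α.isJoin = true then
       (((alpha1 α : ℤ) < j → π.perm i < π.perm j) ∧
        (j ≤ (alpha1 α : ℤ) → π.perm j < π.perm k))
     else π.perm i < π.perm j) : σ.perm i < σ.perm k := by
  obtain ⟨hi, hj, hk, hij, hjk, hj0, hbij, hbjk, hbik, hcov⟩ := hcore
  rw [wle_iff] at hle
  by_contra! hinv
  have hinv' : σ.perm k < σ.perm i :=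
    lt_of_le_of_ne hinv (σ.perm.injective.ne (by omega))
  obtain ⟨i', k', hi', hk', hii, hkk, hvk, hvi, hcov'⟩ :=
    exists_cover_straddling σ hi hk hinv' fun p hp0 h₁ h₂ => by
      by_contra! hp
      have h₃ := σ.perm.injective.ne hp.1.ne
      have h₄ := σ.perm.injective.ne hp.2.ne
      have h₅ := hle i p hp.1 (by omega)
      have h₆ := hle p k hp.2 (by omega)
      have h₇ := π.perm_ne_zero hp0
      rw [hcov] at h₅
      unfold iplus at h₅
      split_ifs at h₅ <;> omega
  have m₁ := blockIdx_mono α hij.le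
  have m₂ := blockIdx_mono α hjk.le
  have m₃ := blockIdx_mono α hii
  have m₄ := blockIdx_mono α hkk
  refine hσ.2 ⟨i', j, k', ⟨hi', hj, hk', by omega, by omega, hj0, by omega, by omega,
    by omega, hcov'⟩, ?_⟩
  have n₁ := hle i j hij
  have n₂ := hle j k hjk
  have n₃ := σ.perm.injective.ne hij.ne
  have n₄ := σ.perm.injective.ne hjk.ne
  split_ifs at hcond ⊢
  · refine ⟨fun h => ?_, fun h => ?_⟩
    · have := hcond.1 h
      omega
    · have := hcond.2 h
      omega
  · omega

/-- The sign-symmetric exchange of the values `v` and `iplus v`. -/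
def exchangeFun (v x : ℤ) : ℤ :=
  if x = v then iplus v
  else if x = iplus v then v
  else if x = -v then -iplus v
  else if x = -iplus v then -v
  else x

theorem exchangeFun_involutive {v : ℤ} (hv : v ≠ 0) : Function.Involutive (exchangeFun v) := by
  intro x
  unfold exchangeFun iplus
  grind

theorem exchangeFun_neg {v : ℤ} (hv : v ≠ 0) (x : ℤ) :
    exchangeFun v (-x) = -exchangeFun v x := by
  unfold exchangeFun iplus
  grind

theorem exchangeFun_lt {v : ℤ} (hv : v ≠ 0) {x y : ℤ} (hxy : x < y) :
    exchangeFun v x < exchangeFun v y ∨ (x = v ∧ y = iplus v) ∨ (x = -iplus v ∧ y = -v) ∨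
      (v = -1 ∧ x = -1 ∧ y = 0) ∨ (v = -1 ∧ x = 0 ∧ y = 1) := by
  unfold exchangeFun iplus
  by_cases h : v = -1
  · subst h
    simp only [if_true, true_and]
    split_ifs <;> omega
  · simp only [if_neg h]
    split_ifs <;> omega

/-- Compose `π` with the exchange of the values `π k` and `iplus (π k) = π i`. -/
def SignedPerm.exchange {n : ℕ} (π : SignedPerm n) (i k : ℤ) (hi : inPM n i) (hk : inPM n k)
    (h : π.perm i = iplus (π.perm k)) : SignedPerm n where
  perm := π.perm.trans (exchangeFun_involutive (π.perm_ne_zero hk.1)).toPerm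
  sign_symm x := by
    change exchangeFun _ (π.perm (-x)) = -exchangeFun _ (π.perm x)
    rw [π.sign_symm, exchangeFun_neg (π.perm_ne_zero hk.1)]
  outside x hx := by
    change exchangeFun _ (π.perm x) = x
    have hi' := π.abs_perm_le (inPM_iff.1 hi).2
    have hk' := π.abs_perm_le (inPM_iff.1 hk).2
    rw [π.outside x hx]
    unfold exchangeFun
    rw [← h]
    rw [abs_le] at hi' hk'
    rw [lt_abs] at hx
    split_ifs <;> omega

section Exchange

variable {n : ℕ} {π : SignedPerm n} {i k : ℤ} (hi : inPM n i) (hk : inPM n k)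
  (h : π.perm i = iplus (π.perm k))

theorem exchange_wle (hik : i < k) : wle (π.exchange i k hi hk h) π := by
  rw [wle_iff]
  intro a b hab (hinv : exchangeFun _ (π.perm b) < exchangeFun _ (π.perm a))
  by_contra! hπ
  have hlt := lt_of_le_of_ne hπ (π.perm.injective.ne hab.ne)
  have hsi := π.sign_symm i
  have hsk := π.sign_symm k
  have inj := fun x y (hxy : π.perm x = π.perm y) => π.perm.injective hxy
  have hz := π.perm_zero
  rcases exchangeFun_lt (π.perm_ne_zero hk.1) hlt with h' | ⟨ha, hb⟩ | ⟨ha, hb⟩ |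
    ⟨hv, ha, hb⟩ | ⟨hv, ha, hb⟩
  · omega
  · have := inj a k ha
    have := inj b i (hb.trans h.symm)
    omega
  · have := inj a (-i) (by rw [ha, hsi, h])
    have := inj b (-k) (by rw [hb, hsk])
    omega
  all_goals
    rw [hv] at h
    have h1 : iplus (-1) = 1 := rfl
    have := inj i (-k) (by omega)
  · have := inj a k (by omega)
    have := inj b 0 (by omega)
    omega
  · have := inj a 0 (by omega)
    have := inj b i (by omega)
    omega

theorem wle_exchange {σ : SignedPerm n} (hle : wle σ π) (hσ : σ.perm i < σ.perm k) :
    wle σ (π.exchange i k hi hk h) := by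
  rw [wle_iff] at hle ⊢
  intro a b hab hinv
  change exchangeFun _ (π.perm b) < exchangeFun _ (π.perm a)
  have hsi := π.sign_symm i
  have hsk := π.sign_symm k
  have inj := fun x y (hxy : π.perm x = π.perm y) => π.perm.injective hxy
  have hz := π.perm_zero
  have hσi := σ.sign_symm i
  have hσk := σ.sign_symm k
  have hσz := σ.perm_zero
  rcases exchangeFun_lt (π.perm_ne_zero hk.1) (hle a b hab hinv) with h' | ⟨hb, ha⟩ |
    ⟨hb, ha⟩ | ⟨hv, hb, ha⟩ | ⟨hv, hb, ha⟩
  · exact h'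
  · obtain rfl := inj b k hb
    obtain rfl := inj a i (ha.trans h.symm)
    omega
  · obtain rfl := inj b (-i) (by rw [hb, hsi, h])
    obtain rfl := inj a (-k) (by rw [ha, hsk])
    omega
  all_goals
    rw [hv] at h
    have h1 : iplus (-1) = 1 := rfl
    have hik := inj i (-k) (by omega)
    rw [hik] at hσ
  · obtain rfl := inj b k (by omega)
    obtain rfl := inj a 0 (by omega)
    omega
  · obtain rfl := inj b 0 (by omega)
    obtain rfl := inj a i (by omega)
    rw [hik] at hinv
    omega

theorem exchange_perm_lt : (π.exchange i k hi hk h).perm i < (π.exchange i k hi hk h).perm k := by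
  change exchangeFun _ (π.perm i) < exchangeFun _ (π.perm k)
  rw [h]
  unfold exchangeFun iplus
  have := π.perm_ne_zero hk.1
  grind

end Exchange

/-- The pairs of positions in `[-n, n]` that form an inversion of `π`. -/
noncomputable def invFinset {n : ℕ} (π : SignedPerm n) : Finset (ℤ × ℤ) :=
  (Finset.Icc (-n : ℤ) n ×ˢ Finset.Icc (-n : ℤ) n).filter
    fun p => p.1 < p.2 ∧ π.perm p.2 < π.perm p.1

theorem card_invFinset_lt {n : ℕ} {σ π : SignedPerm n} (hle : wle σ π) {i k : ℤ}
    (hi : inPM n i) (hk : inPM n k) (hik : i < k) (hπ : π.perm k < π.perm i)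
    (hσ : σ.perm i < σ.perm k) : (invFinset σ).card < (invFinset π).card := by
  rw [wle_iff] at hle
  apply Finset.card_lt_card
  rw [Finset.ssubset_iff_of_subset]
  · refine ⟨(i, k), ?_, ?_⟩
    · simp only [invFinset, Finset.mem_filter, Finset.mem_product, Finset.mem_Icc]
      exact ⟨⟨hi.2, hk.2⟩, hik, hπ⟩
    · simp only [invFinset, Finset.mem_filter]
      exact fun h => absurd h.2.2 hσ.not_gt
  · intro p hp
    simp only [invFinset, Finset.mem_filter] at hp ⊢
    exact ⟨hp.1, hp.2.1, hle _ _ hp.2.1 hp.2.2⟩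

theorem lt_iplus (v : ℤ) : v < iplus v := by
  unfold iplus
  split_ifs <;> omega

theorem exists_isProjDown {n : ℕ} (α : BComp n) (π : SignedPerm n) (hπ : memH α π) :
    ∃ d, isProjDown α π d := by
  induction hc : (invFinset π).card using Nat.strong_induction_on generalizing π with
  | _ c ih =>
  by_cases hpat : has231 α π
  · obtain ⟨i, j, k, hcore, hcond⟩ := hpat
    obtain ⟨hi, hj, hk, hij, hjk, hj0, hbij, hbjk, hbik, hcov⟩ := id hcore
    have hik := hij.trans hjk
    have hle := exchange_wle hi hk hcov hik
    have hcard := card_invFinset_lt hle hi hk hik (hcov ▸ lt_iplus _)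
      (exchange_perm_lt hi hk hcov)
    obtain ⟨d, hd, hdle, hdmax⟩ := ih _ (hc ▸ hcard) _ (memH_of_wle hπ hle) rfl
    exact ⟨d, hd, hdle.trans hle, fun σ hσ hσπ =>
      hdmax σ hσ (wle_exchange hi hk hcov hσπ (not_inv_of_pattern hσ hσπ hcore hcond))⟩
  · exact ⟨π, ⟨hπ, hpat⟩, subset_rfl, fun _ _ h => h⟩

/-- For `π ∈ H_α`, the set `{σ ∈ H_α(231) : Inv σ ⊆ Inv π}`
has a (necessarily unique) greatest element with respect to inclusion of
inversion sets. -/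
theorem projDown_exists_unique (n : ℕ) (hn : 1 ≤ n) (α : BComp n)
    (π : SignedPerm n) (hπ : memH α π) :
    ∃! d : SignedPerm n, isProjDown α π d := by
  obtain ⟨d, hd⟩ := exists_isProjDown α π hπ
  exact ⟨d, hd, fun e he => wle_antisymm (hd.2.2 e he.1 he.2.1) (he.2.2 d hd.1 hd.2.1)⟩

end TypeB
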